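/- Let M be a MAG over V, P its PAG, and let X, Y be non-adjacent in M with p = ⟨X = O_0, ..., O_n = Y⟩ a collider path between X and Y in M that is shortest among all collider paths between X and Y over any subsequence of O_1, ..., O_{n-1}. Then for every 1 ≤ j ≤ n−1, if O_j is not of definite status on p in P, then O_{j+1} is a parent of O_{j-1} in M; and symmetrically, if O_j is not of definite status on p in P, then O_{j-1} is a parent of O_{j+1} in M. (Consequently all non-endpoint nodes of p are of definite status in P.) -/

import Mathlib

open Classical

namespace CG

/-! ### Generic list helpers -/

/-- Consecutive triple on a list. -/
def ListTriple {α : Type} (p : List α) (a b c : α) : Prop :=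
  ∃ i : ℕ, p[i]? = some a ∧ p[i+1]? = some b ∧ p[i+2]? = some c

/-- Consecutive pair (an edge) on a list. -/
def ListEdge {α : Type} (p : List α) (a b : α) : Prop :=
  ∃ i : ℕ, p[i]? = some a ∧ p[i+1]? = some b

/-! ### Mixed graphs (MAGs, PAGs) -/

/-- Edge marks of a mixed graph. -/
inductive Mark : Type
  | tail | arrow | circle
  deriving DecidableEq

/-- A mixed graph over `V`: `mark a b` is the edge mark at `b` on the edge
between `a` and `b` (`none` if there is no edge). -/
structure MixedGraph (V : Type) where
  mark : V → V → Option Mark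

namespace MixedGraph

variable {V : Type} (G : MixedGraph V)

def WellFormed : Prop :=
  (∀ a b : V, (G.mark a b).isSome ↔ (G.mark b a).isSome) ∧ ∀ a : V, G.mark a a = none

def Adj (a b : V) : Prop := (G.mark a b).isSome

/-- Directed edge `a → b`. -/
def DirEdge (a b : V) : Prop := G.mark a b = some Mark.arrow ∧ G.mark b a = some Mark.tail

/-- Bi-directed edge `a ↔ b`. -/
def BiEdge (a b : V) : Prop := G.mark a b = some Mark.arrow ∧ G.mark b a = some Mark.arrow

/-- Edge with circle marks at both ends. -/
def CircleEdge (a b : V) : Prop := G.mark a b = some Mark.circle ∧ G.mark b a = some Mark.circle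

def NoCircles : Prop := ∀ a b : V, G.mark a b ≠ some Mark.circle

def StrictAnc : V → V → Prop := Relation.TransGen G.DirEdge

/-- `a` is an ancestor of `b` (reflexive). -/
def Anc : V → V → Prop := Relation.ReflTransGen G.DirEdge

/-- No directed cycles and no almost-directed cycles. -/
def Ancestral : Prop :=
  (∀ a : V, ¬ G.StrictAnc a a) ∧ ∀ a b : V, G.BiEdge a b → ¬ G.StrictAnc a b

def IsPath (p : List V) : Prop := 2 ≤ p.length ∧ p.Nodup ∧ p.Chain' G.Adj

def IsPathBetween (X Y : V) (p : List V) : Prop :=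
  G.IsPath p ∧ p.head? = some X ∧ p.getLast? = some Y

/-- `b` is a collider between `a` and `c` (arrowheads at `b` on both edges). -/
def Collider (a b c : V) : Prop := G.mark a b = some Mark.arrow ∧ G.mark c b = some Mark.arrow

/-- Every non-endpoint node of `p` is a collider on `p`. -/
def AllColliders (p : List V) : Prop := ∀ a b c : V, ListTriple p a b c → G.Collider a b c

/-- `b` is a definite non-collider between `a` and `c`. -/
def DefNonCollider (a b c : V) : Prop :=
  (G.mark a b = some Mark.tail ∨ G.mark c b = some Mark.tail) ∨
  (G.mark a b = some Mark.circle ∧ G.mark c b = some Mark.circle ∧ ¬ G.Adj a c)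

/-- Every non-endpoint node of `p` is a definite collider or definite non-collider. -/
def DefStatusPath (p : List V) : Prop :=
  ∀ a b c : V, ListTriple p a b c → G.Collider a b c ∨ G.DefNonCollider a b c

/-- The path `p` is into its first node (arrowhead at the first node). -/
def IntoFirst (p : List V) : Prop :=
  ∃ a b : V, p[0]? = some a ∧ p[1]? = some b ∧ G.mark b a = some Mark.arrow

/-- The path `p` is into its last node. -/
def IntoLast (p : List V) : Prop := G.IntoFirst p.reverse

/-- m-connecting path between `X` and `Y` given `Z`. -/
def MConnPath (Z : Set V) (X Y : V) (p : List V) : Prop :=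
  G.IsPathBetween X Y p ∧
  ∀ a b c : V, ListTriple p a b c →
    (G.Collider a b c → ∃ z ∈ Z, G.Anc b z) ∧ (¬ G.Collider a b c → b ∉ Z)

/-- m-separation. -/
def MSep (X Y : V) (Z : Set V) : Prop := ¬ ∃ p : List V, G.MConnPath Z X Y p

/-- Every pair of non-adjacent nodes is m-separated by some set. -/
def Maximal : Prop :=
  ∀ a b : V, a ≠ b → ¬ G.Adj a b → ∃ Z : Set V, a ∉ Z ∧ b ∉ Z ∧ G.MSep a b Z

def IsMAG : Prop := G.WellFormed ∧ G.NoCircles ∧ G.Ancestral ∧ G.Maximal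

/-- Markov equivalence: same m-separation relations. -/
def MarkovEq (G₁ G₂ : MixedGraph V) : Prop :=
  ∀ (X Y : V) (Z : Set V), G₁.MSep X Y Z ↔ G₂.MSep X Y Z

/-- Possibly directed edge step from `a` to `b`: an edge not into `a`. -/
def PossDirStep (a b : V) : Prop := G.Adj a b ∧ G.mark b a ≠ some Mark.arrow

/-- `a` is a possible ancestor of `b`. -/
def PossAnc : V → V → Prop := Relation.ReflTransGen G.PossDirStep

/-- Connected by a circle path (same bucket). -/
def SameBucket : V → V → Prop := Relation.ReflTransGen G.CircleEdge

/-- Bi-directed path in a mixed graph. -/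
def BiPath (p : List V) : Prop := 2 ≤ p.length ∧ p.Nodup ∧ p.Chain' G.BiEdge

/-- Induced subgraph over `A` (all nodes kept; edges outside `A` removed). -/
noncomputable def restrict (A : Set V) : MixedGraph V :=
  ⟨fun a b => if a ∈ A ∧ b ∈ A then G.mark a b else none⟩

end MixedGraph

/-! ### DAGs with latent variables -/

/-- A directed graph over observed nodes `V` and latent nodes `L`. -/
structure LatDAG (V L : Type) where
  edge : V ⊕ L → V ⊕ L → Prop

namespace LatDAG

variable {V L : Type} (D : LatDAG V L)

/-- Acyclic, every latent node is parentless and has exactly two children, both observed. -/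
def IsCausalDAG : Prop :=
  (∀ x : V ⊕ L, ¬ Relation.TransGen D.edge x x) ∧
  (∀ (x : V ⊕ L) (l : L), ¬ D.edge x (Sum.inr l)) ∧
  (∀ l : L, ∃ a b : V, a ≠ b ∧ D.edge (Sum.inr l) (Sum.inl a) ∧ D.edge (Sum.inr l) (Sum.inl b) ∧
    ∀ c : V ⊕ L, D.edge (Sum.inr l) c → c = Sum.inl a ∨ c = Sum.inl b)

def Adj (x y : V ⊕ L) : Prop := D.edge x y ∨ D.edge y x

/-- Ancestor (reflexive). -/
def Anc : V ⊕ L → V ⊕ L → Prop := Relation.ReflTransGen D.edge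

def IsPath (p : List (V ⊕ L)) : Prop := 2 ≤ p.length ∧ p.Nodup ∧ p.Chain' D.Adj

def IsPathBetween (x y : V ⊕ L) (p : List (V ⊕ L)) : Prop :=
  D.IsPath p ∧ p.head? = some x ∧ p.getLast? = some y

/-- The path `p` is into its first node (arrowhead at the first node). -/
def IntoFirst (p : List (V ⊕ L)) : Prop :=
  ∃ a b : V ⊕ L, p[0]? = some a ∧ p[1]? = some b ∧ D.edge b a

def IntoLast (p : List (V ⊕ L)) : Prop := D.IntoFirst p.reverse

/-- Inducing path between observed `X` and `Y` (relative to the latent nodes):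
every non-endpoint observed node is a collider on the path and an ancestor of `X` or `Y`. -/
def InducingPath (X Y : V) (p : List (V ⊕ L)) : Prop :=
  D.IsPathBetween (Sum.inl X) (Sum.inl Y) p ∧
  ∀ a b c : V ⊕ L, ListTriple p a b c → ∀ v : V, b = Sum.inl v →
    (D.edge a b ∧ D.edge c b) ∧ (D.Anc b (Sum.inl X) ∨ D.Anc b (Sum.inl Y))

/-- `a` and `b` are joined by a bi-directed edge, i.e. share a latent parent. -/
def LatentSib (a b : V) : Prop :=
  a ≠ b ∧ ∃ l : L, D.edge (Sum.inr l) (Sum.inl a) ∧ D.edge (Sum.inr l) (Sum.inl b)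

/-- Bi-directed path between observed nodes (listing the observed nodes). -/
def BiPath (p : List V) : Prop := 2 ≤ p.length ∧ p.Nodup ∧ p.Chain' D.LatentSib

/-- Same c-component (reflexive): connected by a bi-directed path. -/
def CConn : V → V → Prop := Relation.ReflTransGen D.LatentSib

/-- Induced subgraph over `A ⊆ V`: keep observed nodes of `A` and the latent nodes
both of whose children are in `A`. -/
def restrict (A : Set V) : LatDAG V L :=
  ⟨fun x y =>
    D.edge x y ∧
    (∀ v : V, x = Sum.inl v → v ∈ A) ∧ (∀ v : V, y = Sum.inl v → v ∈ A) ∧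
    (∀ l : L, x = Sum.inr l → ∀ w : V, D.edge (Sum.inr l) (Sum.inl w) → w ∈ A) ∧
    (∀ l : L, y = Sum.inr l → ∀ w : V, D.edge (Sum.inr l) (Sum.inl w) → w ∈ A)⟩

/-- `F` is a c-forest with root set `R` in `D`. -/
def CForest (F R : Set V) : Prop :=
  R ⊆ F ∧
  (∀ a ∈ F, ∀ b ∈ F, ∀ c ∈ F,
    D.edge (Sum.inl a) (Sum.inl b) → D.edge (Sum.inl a) (Sum.inl c) → b = c) ∧
  R = {a ∈ F | ∀ b ∈ F, ¬ D.edge (Sum.inl a) (Sum.inl b)} ∧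
  (∀ a ∈ F, ∀ b ∈ F, Relation.ReflTransGen (fun u w => u ∈ F ∧ w ∈ F ∧ D.LatentSib u w) a b)

end LatDAG

/-- `M` is the MAG of the DAG `D` over the observed nodes. -/
def IsMAGof {V L : Type} (M : MixedGraph V) (D : LatDAG V L) : Prop :=
  (∀ X Y : V, M.Adj X Y ↔ ∃ p : List (V ⊕ L), D.InducingPath X Y p) ∧
  ∀ X Y : V, M.Adj X Y →
    (M.DirEdge X Y ↔ D.Anc (Sum.inl X) (Sum.inl Y)) ∧
    (M.BiEdge X Y ↔ ¬ D.Anc (Sum.inl X) (Sum.inl Y) ∧ ¬ D.Anc (Sum.inl Y) (Sum.inl X))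

/-- The directed edge `A → B` of the MAG `M` is visible: no DAG whose MAG is `M`
has an inducing path between `A` and `B` that is into `A`. -/
def MagVisible {V : Type} (M : MixedGraph V) (A B : V) : Prop :=
  M.DirEdge A B ∧
  ∀ (L : Type) (D : LatDAG V L), D.IsCausalDAG → IsMAGof M D →
    ¬ ∃ p : List (V ⊕ L), D.InducingPath A B p ∧ D.IntoFirst p

/-- `P` is the PAG of the MAG `M`: same adjacencies, and an arrowhead/tail mark appears
in `P` iff it appears in every Markov equivalent MAG. -/
def IsPAGof {V : Type} (P M : MixedGraph V) : Prop :=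
  (∀ a b : V, P.Adj a b ↔ M.Adj a b) ∧
  ∀ a b : V, P.Adj a b →
    ((P.mark a b = some Mark.arrow ↔
        ∀ M' : MixedGraph V, M'.IsMAG → MixedGraph.MarkovEq M M' →
          M'.mark a b = some Mark.arrow) ∧
     (P.mark a b = some Mark.tail ↔
        ∀ M' : MixedGraph V, M'.IsMAG → MixedGraph.MarkovEq M M' →
          M'.mark a b = some Mark.tail))

/-- The directed edge `A → B` of a PAG `P` is visible: `A → B` in `P` and the edge is
visible in every MAG of the equivalence class represented by `P`. -/
def PagVisible {V : Type} (P : MixedGraph V) (A B : V) : Prop :=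
  P.DirEdge A B ∧ ∀ M : MixedGraph V, M.IsMAG → IsPAGof P M → MagVisible M A B

/-- `X` and `Y` are in the same pc-component of the MAG `M`. -/
def SamePCCompMag {V : Type} (M : MixedGraph V) (X Y : V) : Prop :=
  X = Y ∨ ∃ p : List V, M.IsPathBetween X Y p ∧ M.AllColliders p ∧
    ∀ a b : V, ListEdge p a b → ¬ MagVisible M a b ∧ ¬ MagVisible M b a

/-- `X` and `Y` are in the same pc-component of the PAG `P`. -/
def SamePCCompPag {V : Type} (P : MixedGraph V) (X Y : V) : Prop :=
  X = Y ∨ ∃ p : List V, P.IsPathBetween X Y p ∧ P.AllColliders p ∧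
    ∀ a b : V, ListEdge p a b → ¬ PagVisible P a b ∧ ¬ PagVisible P b a

/-- `D` is a DAG in the Markov equivalence class represented by the PAG `P`. -/
def DagInClass {V L : Type} (P : MixedGraph V) (D : LatDAG V L) : Prop :=
  ∃ M : MixedGraph V, M.IsMAG ∧ IsMAGof M D ∧ IsPAGof P M

/-- `C` is a possible child of `X` in a PAG: they are adjacent, the mark at `X` is not
an arrowhead and the mark at `C` is not a tail. -/
def PossChild {V : Type} (P : MixedGraph V) (X C : V) : Prop :=
  P.Adj X C ∧ P.mark C X ≠ some Mark.arrow ∧ P.mark X C ≠ some Mark.tail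

/-- The dc-component of the set `X` in a mixed graph. -/
def DCComp {V : Type} (G : MixedGraph V) (X : Set V) : Set V :=
  {a | ∃ x ∈ X, Relation.ReflTransGen G.BiEdge x a}

/-- The identification criterion of the theorem: no node `Xi ∈ X` is in the same
pc-component of `P_T` with a possible child `C ∈ T \ X`. -/
def BucketCrit {V : Type} (P : MixedGraph V) (T X : Set V) : Prop :=
  ¬ ∃ Xi ∈ X, ∃ C, C ∈ T ∧ C ∉ X ∧
    PossChild (P.restrict T) Xi C ∧ SamePCCompPag (P.restrict T) Xi C

/-- `B 1 < ... < B m` is a partial topological order over the buckets of `G` covering `T`. -/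
def IsBucketTopEnum {V : Type} (G : MixedGraph V) (T : Set V)
    {m : ℕ} (B : Fin m → Set V) : Prop :=
  (∀ i, (B i).Nonempty) ∧ (∀ i, B i ⊆ T) ∧ (⋃ i, B i) = T ∧
  (∀ i j, i ≠ j → Disjoint (B i) (B j)) ∧
  (∀ i, ∀ a ∈ B i, B i = {b | G.SameBucket a b}) ∧
  (∀ i j, i ≠ j → ∀ a ∈ B i, ∀ b ∈ B j, G.mark a b = some Mark.arrow → i < j)

/-- `B` is a bucket of `G` (with representative in `T`). -/
def IsBucketOf {V : Type} (G : MixedGraph V) (T B : Set V) : Prop :=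
  ∃ a ∈ T, B = {b | G.SameBucket a b}

/-! ### Discrete causal models and c-factors -/

/-- A discrete causal model of a DAG `D`, with observed variables valued in `Ω`. -/
structure CModel {V L : Type} [DecidableEq V] [DecidableEq L]
    (D : LatDAG V L) (Ω : Type) [Fintype Ω] where
  latS : L → Type
  latFin : ∀ l : L, Fintype (latS l)
  latNE : ∀ l : L, Nonempty (latS l)
  cpt : V ⊕ L → (V → Ω) × (∀ l : L, latS l) → ℝ
  cpt_nonneg : ∀ x c, 0 ≤ cpt x c
  cpt_local : ∀ (x : V ⊕ L) (c c' : (V → Ω) × (∀ l : L, latS l)),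
    (∀ v : V, (x = Sum.inl v ∨ D.edge (Sum.inl v) x) → c.1 v = c'.1 v) →
    (∀ l : L, (x = Sum.inr l ∨ D.edge (Sum.inr l) x) → c.2 l = c'.2 l) →
    cpt x c = cpt x c'
  cpt_norm_obs : ∀ (v : V) (c : (V → Ω) × (∀ l : L, latS l)),
    ∑ ω : Ω, cpt (Sum.inl v) (Function.update c.1 v ω, c.2) = 1
  cpt_norm_lat : ∀ (l : L) (c : (V → Ω) × (∀ l : L, latS l)),
    ((@Finset.univ (latS l) (latFin l)).sum
      fun s => cpt (Sum.inr l) (c.1, Function.update c.2 l s)) = 1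

/-- The c-factor `Q[T]`, as a function of a full assignment to the observed variables
(the values outside `T` play the role of the intervention values). -/
noncomputable def CModel.Q {V L : Type} [Fintype V] [DecidableEq V] [Fintype L]
    [DecidableEq L] {D : LatDAG V L} {Ω : Type} [Fintype Ω]
    (M : CModel D Ω) (T : Set V) (c : V → Ω) : ℝ :=
  letI : ∀ l : L, Fintype (M.latS l) := M.latFin
  ∑ g : ∀ l : L, M.latS l,
    (∏ v : V, if v ∈ T then M.cpt (Sum.inl v) (c, g) else 1) *
      ∏ l : L, M.cpt (Sum.inr l) (c, g)

/-- `Q[T \ X]` is identifiable from `Q[T]` in the PAG `P`: a single functional maps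
`Q[T]` to `Q[T \ X]` uniformly over every DAG in the class represented by `P`. -/
def QIdentifiable {V : Type} [Fintype V] [DecidableEq V]
    (P : MixedGraph V) (T X : Set V) : Prop :=
  ∀ (Ω : Type) [Fintype Ω] [Nonempty Ω],
    ∃ F : ((V → Ω) → ℝ) → ((V → Ω) → ℝ),
      ∀ (L : Type) [Fintype L] [DecidableEq L] (D : LatDAG V L),
        D.IsCausalDAG → DagInClass P D →
        ∀ M : CModel D Ω, F (M.Q T) = M.Q (T \ X)

/-- `Q[T \ X]` is identifiable from `Q[T]` in the DAG `D`. -/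
def DagIdentifiable {V L : Type} [Fintype V] [DecidableEq V] [Fintype L] [DecidableEq L]
    (D : LatDAG V L) (T X : Set V) : Prop :=
  ∀ (Ω : Type) [Fintype Ω] [Nonempty Ω],
    ∃ F : ((V → Ω) → ℝ) → ((V → Ω) → ℝ),
      ∀ M : CModel D Ω, F (M.Q T) = M.Q (T \ X)

/-- Probability, under the distribution `q` over the variables of `T` (context fixed
outside `T`), that the variables of `W` take the values given by `c`. -/
noncomputable def MarginProb {V Ω : Type} [Fintype V] [Fintype Ω]
    (T : Set V) (q : (V → Ω) → ℝ) (W : Set V) (c : V → Ω) : ℝ :=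
  ∑ d : V → Ω, if (∀ v : V, (v ∈ W ∨ v ∉ T) → d v = c v) then q d else 0

/-- Conditional term `P_{v\t}(Bi | Prev)` computed from `q = Q[T]`. -/
noncomputable def CondTerm {V Ω : Type} [Fintype V] [Fintype Ω]
    (T : Set V) (q : (V → Ω) → ℝ) (Bi Prev : Set V) (c : V → Ω) : ℝ :=
  MarginProb T q (Bi ∪ Prev) c / MarginProb T q Prev c

/-- Product of the conditional terms of the buckets contained in the dc-component of `X`. -/
noncomputable def BucketDenom {V Ω : Type} [Fintype V] [Fintype Ω]
    (P : MixedGraph V) (T X : Set V) {m : ℕ} (B : Fin m → Set V)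
    (q : (V → Ω) → ℝ) (c : V → Ω) : ℝ :=
  ∏ i ∈ Finset.univ.filter (fun i : Fin m => B i ⊆ DCComp (P.restrict T) X),
    CondTerm T q (B i) {v | ∃ j : Fin m, j < i ∧ v ∈ B j} c

/-- The identification formula: `Q[T\X] = (Q[T] / ∏ P(B_i | B^{(i-1)})) · Σ_x ∏ P(B_i |
B^{(i-1)})`, the product over the buckets of `P_T` inside the dc-component of `X` in a
partial topological order, summed over the values of `X` in the numerator. -/
def BucketFormula {V : Type} [Fintype V] [DecidableEq V]
    (P : MixedGraph V) (T X : Set V) : Prop :=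
  ∀ (m : ℕ) (B : Fin m → Set V), IsBucketTopEnum (P.restrict T) T B →
    ∀ (Ω : Type) [Fintype Ω] [Nonempty Ω] (L : Type) [Fintype L] [DecidableEq L]
      (D : LatDAG V L), D.IsCausalDAG → DagInClass P D →
      ∀ (M : CModel D Ω) (c : V → Ω),
        M.Q (T \ X) c =
          M.Q T c / BucketDenom P T X B (M.Q T) c *
            ∑ d : V → Ω,
              if (∀ v : V, v ∉ X → d v = c v) then BucketDenom P T X B (M.Q T) d else 0

/-- A hedge for `Q[W]` (`W = T \ X`) formed by the intervention set `X`. -/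
def IsHedge {V L : Type} (D : LatDAG V L) (W X : Set V) (F F' : Set V) : Prop :=
  ∃ R : Set V, R ⊆ W ∧ F' ⊆ F ∧ F ⊆ W ∪ X ∧ (F ∩ X).Nonempty ∧ F' ∩ X = ∅ ∧
    D.CForest F R ∧ D.CForest F' R

/-! ### Adjustment, GAC and the IDP algorithm -/

/-- Proper possibly directed path from the set `X` to the set `Y` in a PAG. -/
def ProperPDPath {V : Type} (P : MixedGraph V) (X Y : Set V) (p : List V) : Prop :=
  P.IsPath p ∧ (∃ x ∈ X, p.head? = some x) ∧ (∃ y ∈ Y, p.getLast? = some y) ∧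
  (∀ v ∈ p.tail, v ∉ X) ∧ ∀ a b : V, ListEdge p a b → P.mark b a ≠ some Mark.arrow

/-- `P` is amenable relative to `(X, Y)`: every proper possibly directed path from `X`
to `Y` starts with a visible directed edge out of `X`. -/
def Amenable {V : Type} (P : MixedGraph V) (X Y : Set V) : Prop :=
  ∀ p : List V, ProperPDPath P X Y p →
    ∃ a b : V, p[0]? = some a ∧ p[1]? = some b ∧ PagVisible P a b

/-- The forbidden set: possible descendants of nodes `w ∉ X` lying on proper possibly
directed paths from `X` to `Y`. -/
def Forb {V : Type} (P : MixedGraph V) (X Y : Set V) : Set V :=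
  {d | ∃ (w : V) (p : List V), ProperPDPath P X Y p ∧ w ∈ p ∧ w ∉ X ∧ P.PossAnc w d}

/-- Proper definite status non-causal path from `X` to `Y`. -/
def ProperDefNonCausal {V : Type} (P : MixedGraph V) (X Y : Set V) (p : List V) : Prop :=
  P.IsPath p ∧ P.DefStatusPath p ∧ (∃ x ∈ X, p.head? = some x) ∧
  (∃ y ∈ Y, p.getLast? = some y) ∧ (∀ v ∈ p.tail, v ∉ X) ∧
  ∃ a b : V, ListEdge p a b ∧ P.mark b a = some Mark.arrow

/-- `Z` blocks the definite status path `p`. -/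
def BlocksPath {V : Type} (P : MixedGraph V) (Z : Set V) (p : List V) : Prop :=
  (∃ a b c : V, ListTriple p a b c ∧ P.DefNonCollider a b c ∧ b ∈ Z) ∨
  (∃ a b c : V, ListTriple p a b c ∧ P.Collider a b c ∧ ∀ z ∈ Z, ¬ P.PossAnc b z)

/-- `Z` satisfies the generalized adjustment criterion relative to `(X, Y)` in `P`. -/
def SatGAC {V : Type} (P : MixedGraph V) (X Y Z : Set V) : Prop :=
  Amenable P X Y ∧ Z ∩ Forb P X Y = ∅ ∧
  ∀ p : List V, ProperDefNonCausal P X Y p → BlocksPath P Z p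

/-- The canonical adjustment set `Adjust(X, Y, P)`. -/
def AdjustSet {V : Type} (P : MixedGraph V) (X Y : Set V) : Set V :=
  {v | ∃ w ∈ X ∪ Y, P.PossAnc v w} \ (Forb P X Y ∪ X ∪ Y)

/-- The subroutine `Identify(C, T, Q[T])` of IDP succeeds: it repeatedly removes a
bucket of `P_T` disjoint from `C` satisfying the interventional criterion, until `T = C`. -/
inductive IdentifySucc {V : Type} (P : MixedGraph V) (C : Set V) : Set V → Prop
  | base : IdentifySucc P C C
  | step (T B : Set V) (hBT : B ⊆ T) (hBC : Disjoint B C) (hne : B.Nonempty)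
      (hbucket : IsBucketOf (P.restrict T) T B) (hcrit : BucketCrit P T B)
      (h : IdentifySucc P C (T \ B)) : IdentifySucc P C T

/-- The IDP algorithm succeeds on `P_x(y)`: with `D` the set of possible ancestors of `Y`
in `P_{V \ X}`, every cpc-component of `P_D` is identified by `Identify` from `Q[V]`. -/
def IDPSucc {V : Type} (P : MixedGraph V) (X Y : Set V) : Prop :=
  ∀ a ∈ {d : V | ∃ y ∈ Y, (P.restrict Xᶜ).PossAnc d y},
    IdentifySucc P
      {b : V | b ∈ {d : V | ∃ y ∈ Y, (P.restrict Xᶜ).PossAnc d y} ∧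
        Relation.ReflTransGen
          (fun u w =>
            SamePCCompPag (P.restrict {d : V | ∃ y ∈ Y, (P.restrict Xᶜ).PossAnc d y}) u w ∨
            (P.restrict {d : V | ∃ y ∈ Y, (P.restrict Xᶜ).PossAnc d y}).SameBucket u w)
          a b}
      Set.univ

/-- Definite m-connecting path in a PAG given `Z`. -/
def DefMConnPath {V : Type} (P : MixedGraph V) (Z : Set V) (X Y : V) (p : List V) : Prop :=
  P.IsPathBetween X Y p ∧
  ∀ a b c : V, ListTriple p a b c →
    (P.Collider a b c → ∃ z ∈ Z, P.PossAnc b z) ∧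
    (¬ P.Collider a b c → P.DefNonCollider a b c ∧ b ∉ Z)


namespace MixedGraph

variable {V : Type} {G : MixedGraph V}

theorem adj_of_mark {a b : V} {m : Mark} (h : G.mark a b = some m) : G.Adj a b := by
  simp [Adj, h]

theorem WellFormed.adj_symm (hG : G.WellFormed) {a b : V} (h : G.Adj a b) : G.Adj b a :=
  (hG.1 a b).1 h

theorem WellFormed.ne_of_adj (hG : G.WellFormed) {a b : V} (h : G.Adj a b) : a ≠ b := by
  rintro rfl
  simp [Adj, hG.2 a] at h

theorem NoCircles.arrow_or_tail (hG : G.NoCircles) {a b : V} (h : G.Adj a b) :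
    G.mark a b = some Mark.arrow ∨ G.mark a b = some Mark.tail := by
  obtain ⟨m, hm⟩ := Option.isSome_iff_exists.1 h
  cases m with
  | tail => exact Or.inr hm
  | arrow => exact Or.inl hm
  | circle => exact absurd hm (hG a b)

/-- The triple `a, b, c` does not block given `Z`; colliders are required to lie in `Z` itself. -/
def OpenTriple (G : MixedGraph V) (Z : Set V) (a b c : V) : Prop :=
  (G.Collider a b c → b ∈ Z) ∧ (¬ G.Collider a b c → b ∉ Z)

/-- `OpenPath G Z y a L`: the list `a :: L` is a path ending in `y` with all its triples open. -/
inductive OpenPath (G : MixedGraph V) (Z : Set V) (y : V) : V → List V → Prop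
  | nil : OpenPath G Z y y []
  | cons {a b : V} {L : List V} (hL : OpenPath G Z y b L) (hab : a ≠ b) (ha : a ∉ L)
      (hadj : G.Adj a b) (hopen : ∀ c ∈ L.head?, G.OpenTriple Z a b c) :
      OpenPath G Z y a (b :: L)

namespace OpenPath

variable {Z : Set V} {x y a v : V} {L : List V}

theorem exists_suffix (h : OpenPath G Z y a L) (hv : v ∈ L) :
    ∃ L', OpenPath G Z y v L' ∧ L' ⊆ L := by
  induction h with
  | nil => simp at hv
  | @cons a b L hL hab ha hadj hopen ih =>
    rcases List.mem_cons.1 hv with rfl | hv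
    · exact ⟨L, hL, List.subset_cons_self _ _⟩
    · obtain ⟨L', h1, h2⟩ := ih hv
      exact ⟨L', h1, List.subset_cons_of_subset _ h2⟩

theorem nodup (h : OpenPath G Z y a L) : (a :: L).Nodup := by
  induction h with
  | nil => simp
  | @cons a b L hL hab ha hadj hopen ih =>
    refine List.nodup_cons.2 ⟨?_, ih⟩
    simp [hab, ha]

theorem isChain (h : OpenPath G Z y a L) : (a :: L).IsChain G.Adj := by
  induction h with
  | nil => simp
  | @cons a b L hL hab ha hadj hopen ih => exact List.isChain_cons_cons.2 ⟨hadj, ih⟩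

theorem getLast?_eq (h : OpenPath G Z y a L) : (a :: L).getLast? = some y := by
  induction h with
  | nil => simp
  | @cons a b L hL hab ha hadj hopen ih => simpa using ih

theorem openTriple (h : OpenPath G Z y a L) {b c d : V} (ht : ListTriple (a :: L) b c d) :
    G.OpenTriple Z b c d := by
  induction h with
  | nil => obtain ⟨i, -, h2, -⟩ := ht; simp at h2
  | @cons a e L hL hab ha hadj hopen ih =>
    obtain ⟨i, h1, h2, h3⟩ := ht
    cases i with
    | zero =>
      simp only [List.getElem?_cons_zero, Option.some.injEq, zero_add,
        List.getElem?_cons_succ] at h1 h2 h3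
      subst h1 h2
      exact hopen d (by rw [List.head?_eq_getElem?]; simpa using h3)
    | succ i => exact ih ⟨i, by simpa using h1, by simpa using h2, by simpa using h3⟩

theorem not_mSep (h : OpenPath G Z y x L) (hxy : x ≠ y) : ¬ G.MSep x y Z := by
  refine fun hs => hs ⟨x :: L, ⟨⟨?_, h.nodup, h.isChain⟩, rfl, h.getLast?_eq⟩, ?_⟩
  · cases h with
    | nil => exact absurd rfl hxy
    | cons => simp
  · intro a b c ht
    exact ⟨fun hc => ⟨b, (h.openTriple ht).1 hc, Relation.ReflTransGen.refl⟩,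
      (h.openTriple ht).2⟩

end OpenPath

/-- `u` is connected to `e` by a walk through `W` each of whose nodes has a tail mark on the edge
towards `e`. -/
inductive Arm (G : MixedGraph V) (W : Set V) (e : V) : V → Prop
  | base {u : V} (hu : u ∈ W) (h : G.mark e u = some Mark.tail) : Arm G W e u
  | step {u w : V} (hu : u ∈ W) (h : G.mark w u = some Mark.tail) (hw : Arm G W e w) : Arm G W e u

/-- The path version of `Arm`. -/
inductive TailPath (G : MixedGraph V) (W : Set V) (e : V) : V → List V → Prop
  | nil : TailPath G W e e []
  | cons {a b : V} {L : List V} (hL : TailPath G W e b L) (hab : a ≠ b) (ha : a ∉ L)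
      (haW : a ∈ W) (h : G.mark b a = some Mark.tail) : TailPath G W e a (b :: L)

namespace TailPath

variable {Z W : Set V} {e a v : V} {L : List V}

theorem exists_suffix (h : TailPath G W e a L) (hv : v ∈ L) :
    ∃ L', TailPath G W e v L' := by
  induction h with
  | nil => simp at hv
  | @cons a b L hL hab ha haW h ih =>
    rcases List.mem_cons.1 hv with rfl | hv
    · exact ⟨L, hL⟩
    · exact ih hv

theorem mem (h : TailPath G W e a L) (hv : v ∈ L) : v ∈ W ∨ v = e := by
  induction h with
  | nil => simp at hv
  | @cons a b L hL hab ha haW h ih =>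
    rcases List.mem_cons.1 hv with rfl | hv
    · cases hL with
      | nil => exact Or.inr rfl
      | cons _ _ _ h _ => exact Or.inl h
    · exact ih hv

theorem mark_head (h : TailPath G W e a L) : ∀ c ∈ L.head?, G.mark c a = some Mark.tail := by
  cases h with
  | nil => simp
  | cons _ _ _ _ h => simpa using h

theorem mem_of_head (h : TailPath G W e a L) : ∀ c ∈ L.head?, a ∈ W := by
  cases h with
  | nil => simp
  | cons _ _ _ h _ => exact fun _ _ => h

theorem openPath (h : TailPath G W e a L) (hG : G.WellFormed) (hWZ : Disjoint W Z) :
    OpenPath G Z e a L := by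
  induction h with
  | nil => exact .nil
  | @cons a b L hL hab ha haW h ih =>
    refine .cons ih hab ha (hG.adj_symm (adj_of_mark h)) fun c hc => ?_
    have hm := hL.mark_head c hc
    refine ⟨fun hcol => ?_, fun _ => ?_⟩
    · simp [hcol.2] at hm
    · exact Set.disjoint_left.1 hWZ (hL.mem_of_head c hc)

end TailPath

namespace Arm

variable {Z W : Set V} {e x y u : V}

theorem mem (h : G.Arm W e u) : u ∈ W := by cases h <;> assumption

theorem exists_tailPath (h : G.Arm W e u) (he : e ∉ W) : ∃ L, TailPath G W e u L := by
  induction h with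
  | base hu h => exact ⟨_, .cons .nil (fun h => he (h ▸ hu)) (by simp) hu h⟩
  | @step u w hu h hw ih =>
    obtain ⟨L, hL⟩ := ih
    by_cases huw : u = w
    · exact ⟨L, huw ▸ hL⟩
    by_cases huL : u ∈ L
    · exact hL.exists_suffix huL
    · exact ⟨_, .cons hL huw huL hu h⟩

/-- An open path starting at `u` can be continued through an arm from `u` to `x`. -/
theorem exists_openPath (h : G.Arm W x u) (hWZ : Disjoint W Z) (hx : x ∉ W)
    {L : List V} (hL : OpenPath G Z y u L) (hxL : x ∉ L) : ∃ L', OpenPath G Z y x L' := by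
  induction h generalizing L with
  | @base u hu h =>
    refine ⟨_, .cons hL (fun h => hx (h ▸ hu)) hxL (adj_of_mark h) fun c _ =>
      ⟨fun hc => ?_, fun _ => Set.disjoint_left.1 hWZ hu⟩⟩
    simp [hc.1] at h
  | @step u w hu h hw ih =>
    by_cases hwu : w = u
    · subst hwu; exact ih hL hxL
    by_cases hwL : w ∈ L
    · obtain ⟨L', h1, h2⟩ := hL.exists_suffix hwL
      exact ih h1 fun hc => hxL (h2 hc)
    · refine ih (.cons hL hwu hwL (adj_of_mark h) fun c _ =>
        ⟨fun hc => ?_, fun _ => Set.disjoint_left.1 hWZ hu⟩) ?_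
      · simp [hc.1] at h
      · simp only [List.mem_cons, not_or]
        exact ⟨fun h => hx (h ▸ hu), hxL⟩

end Arm

/-- Prepending a segment of `f` to an open path. -/
theorem OpenPath.prepend {Z : Set V} {y : V} {f : ℕ → V} {t : ℕ} {L : List V}
    (hL : OpenPath G Z y (f t) L) {s : ℕ} (hst : s ≤ t)
    (hinj : Set.InjOn f (Set.Icc s t)) (hdisj : ∀ i, s ≤ i → i < t → f i ∉ L)
    (hadj : ∀ i, s ≤ i → i < t → G.Adj (f i) (f (i + 1)))
    (hopen : ∀ i, s < i → i < t → G.OpenTriple Z (f (i - 1)) (f i) (f (i + 1)))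
    (hlast : ∀ c ∈ L.head?, G.OpenTriple Z (f (t - 1)) (f t) c) :
    ∃ L', OpenPath G Z y (f s) L' ∧ (∀ v ∈ L', v ∈ L ∨ ∃ i, s < i ∧ i ≤ t ∧ v = f i) ∧
      (s < t → L'.head? = some (f (s + 1))) ∧ (s = t → L' = L) := by
  induction hd : t - s generalizing s with
  | zero =>
    obtain rfl : s = t := by omega
    exact ⟨L, hL, fun v hv => Or.inl hv, fun h => absurd h (lt_irrefl _), fun _ => rfl⟩
  | succ d ih =>
    obtain ⟨L', h1, h2, h3, h4⟩ := ih (s := s + 1) (by omega)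
      (hinj.mono (Set.Icc_subset_Icc_left (by omega))) (fun i h => hdisj i (by omega))
      (fun i h => hadj i (by omega)) (fun i h => hopen i (by omega)) (by omega)
    have hne : ∀ i, s < i → i ≤ t → f s ≠ f i := fun i h h' he => by
      have := hinj (Set.mem_Icc.2 ⟨le_rfl, hst⟩) (Set.mem_Icc.2 ⟨h.le, h'⟩) he
      omega
    refine ⟨f (s + 1) :: L', .cons h1 (hne _ (by omega) (by omega)) ?_
      (hadj s le_rfl (by omega)) ?_, ?_, fun _ => rfl, by omega⟩
    · intro hc
      rcases h2 _ hc with hc | ⟨i, hi, hi', he⟩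
      · exact hdisj s le_rfl (by omega) hc
      · exact hne i (by omega) hi' he
    · intro c hc
      rcases Nat.lt_or_ge (s + 1) t with hlt | hge
      · rw [h3 hlt] at hc
        obtain rfl : f (s + 1 + 1) = c := by simpa using hc
        exact hopen (s + 1) (by omega) hlt
      · obtain rfl : t = s + 1 := by omega
        rw [h4 rfl] at hc
        exact hlast c hc
    · intro v hv
      rcases List.mem_cons.1 hv with rfl | hv
      · exact Or.inr ⟨s + 1, by omega, by omega, rfl⟩
      · rcases h2 v hv with h | ⟨i, hi, hi', he⟩
        · exact Or.inl h
        · exact Or.inr ⟨i, by omega, hi', he⟩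

/-- The edge between `f x` and `f y` has an arrowhead at each of its ends that lies strictly inside
the segment of `f` from `k` to `l`. -/
def ColliderStep (G : MixedGraph V) (f : ℕ → V) (k l x y : ℕ) : Prop :=
  G.Adj (f x) (f y) ∧ (k < x → G.mark (f y) (f x) = some Mark.arrow) ∧
    (y < l → G.mark (f x) (f y) = some Mark.arrow)

/-- `f k, …, f l` is a collider path. -/
structure ColliderSeg (G : MixedGraph V) (f : ℕ → V) (k l : ℕ) : Prop where
  inj : Set.InjOn f (Set.Icc k l)
  step : ∀ i, k ≤ i → i < l → G.ColliderStep f k l i (i + 1)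

namespace ColliderSeg

variable {f : ℕ → V} {k l : ℕ} {Z : Set V} {W : Set ℕ}

theorem ne (hp : G.ColliderSeg f k l) {i j : ℕ} (hi : k ≤ i) (hij : i < j) (hj : j ≤ l) :
    f i ≠ f j := fun h => by
  have := hp.inj (Set.mem_Icc.2 ⟨hi, by omega⟩) (Set.mem_Icc.2 ⟨by omega, hj⟩) h
  omega

theorem collider (hp : G.ColliderSeg f k l) {i : ℕ} (hi : k < i) (hi' : i < l) :
    G.Collider (f (i - 1)) (f i) (f (i + 1)) := by
  have h := (hp.step (i - 1) (by omega) (by omega)).2.2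
  rw [Nat.sub_add_cancel (by omega : 1 ≤ i)] at h
  exact ⟨h hi', (hp.step i hi.le hi').2.1 hi⟩

theorem mono (hp : G.ColliderSeg f k l) {a b : ℕ} (ha : k ≤ a) (hb : b ≤ l) :
    G.ColliderSeg f a b :=
  ⟨hp.inj.mono (Set.Icc_subset_Icc ha hb), fun i hi hi' =>
    have h := hp.step i (by omega) (by omega)
    ⟨h.1, fun h' => h.2.1 (by omega), fun h' => h.2.2 (by omega)⟩⟩

/-- A node joined to `f k` by an arm and a later node joined to `f l` by an arm m-connect the ends
when all nodes in between lie in `Z`. -/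
theorem not_mSep (hp : G.ColliderSeg f k l) (hG : G.WellFormed)
    (hW : ∀ i ∈ W, k < i ∧ i < l ∧ f i ∉ Z) {x y : ℕ} (hkx : k ≤ x) (hxy : x < y) (hyl : y ≤ l)
    (hx : x = k ∨ G.Arm (f '' W) (f k) (f x)) (hy : y = l ∨ G.Arm (f '' W) (f l) (f y))
    (hZ : ∀ i, x < i → i < y → f i ∈ Z) : ¬ G.MSep (f k) (f l) Z := by
  have hWZ : Disjoint (f '' W) Z := by
    rw [Set.disjoint_left]
    rintro _ ⟨i, hi, rfl⟩
    exact (hW i hi).2.2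
  have hkW : f k ∉ f '' W := by
    rintro ⟨i, hi, h⟩
    exact hp.ne le_rfl (hW i hi).1 (hW i hi).2.1.le h.symm
  have hlW : f l ∉ f '' W := by
    rintro ⟨i, hi, h⟩
    exact hp.ne (hW i hi).1.le (hW i hi).2.1 le_rfl h
  have hkl : f k ≠ f l := hp.ne le_rfl (by omega) le_rfl
  suffices h : ∃ L, OpenPath G Z (f l) (f k) L from h.elim fun L hL => hL.not_mSep hkl
  obtain ⟨L, hL⟩ : ∃ L, TailPath G (f '' W) (f l) (f y) L := by
    rcases hy with rfl | hy
    · exact ⟨[], .nil⟩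
    · exact hy.exists_tailPath hlW
  have hLo := hL.openPath hG hWZ
  have hkL : f k ∉ L := fun h => (hL.mem h).elim hkW hkl
  by_cases hxL : f x ∈ L
  · obtain ⟨L', h1, h2⟩ := hLo.exists_suffix hxL
    rcases hx with rfl | hx
    · exact ⟨L', h1⟩
    · exact hx.exists_openPath hWZ hkW h1 fun h => hkL (h2 h)
  have hdisj : ∀ i, x ≤ i → i < y → f i ∉ L := by
    intro i hi hi' h
    rcases hi.eq_or_lt with rfl | hi
    · exact hxL h
    · rcases hL.mem h with h | h
      · exact Set.disjoint_left.1 hWZ h (hZ i hi hi')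
      · exact hp.ne (by omega) (by omega) le_rfl h
  have hlast : ∀ c ∈ L.head?, G.OpenTriple Z (f (y - 1)) (f y) c := by
    intro c hc
    have hm := hL.mark_head c hc
    exact ⟨fun h => by simp [h.2] at hm, fun _ => Set.disjoint_left.1 hWZ (hL.mem_of_head c hc)⟩
  obtain ⟨L', h1, h2, -⟩ := hLo.prepend hxy.le
    (hp.inj.mono (Set.Icc_subset_Icc hkx hyl)) hdisj
    (fun i hi hi' => (hp.step i (by omega) (by omega)).1)
    (fun i hi hi' => ⟨fun _ => hZ i hi hi', fun h =>
      absurd (hp.collider (by omega) (by omega)) h⟩) hlast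
  rcases hx with rfl | hx
  · exact ⟨L', h1⟩
  refine hx.exists_openPath hWZ hkW h1 fun h => ?_
  rcases h2 _ h with h | ⟨i, hi, hi', h⟩
  · exact hkL h
  · exact hp.ne le_rfl (by omega) (by omega) h

/-- If every non-member of `Z` between `x` and `y` is joined to an end of the segment by an arm,
then the ends are m-connected. -/
theorem not_mSep_of_arms (hp : G.ColliderSeg f k l) (hG : G.WellFormed)
    (hW : ∀ i ∈ W, k < i ∧ i < l ∧ f i ∉ Z)
    (harm : ∀ i ∈ W, G.Arm (f '' W) (f k) (f i) ∨ G.Arm (f '' W) (f l) (f i))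
    {x y : ℕ} (hkx : k ≤ x) (hxy : x < y) (hyl : y ≤ l)
    (hx : x = k ∨ G.Arm (f '' W) (f k) (f x)) (hy : y = l ∨ G.Arm (f '' W) (f l) (f y))
    (hZ : ∀ i, x < i → i < y → f i ∈ Z ∨ i ∈ W) : ¬ G.MSep (f k) (f l) Z := by
  induction hd : y - x using Nat.strong_induction_on generalizing x y with
  | _ d ih =>
    by_cases h : ∀ i, x < i → i < y → f i ∈ Z
    · exact hp.not_mSep hG hW hkx hxy hyl hx hy h
    push Not at h
    obtain ⟨i, hi, hi', hiZ⟩ := h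
    rcases harm i ((hZ i hi hi').resolve_left hiZ) with h | h
    · exact ih (y - i) (by omega) (by omega) hi' hyl (Or.inr h) hy
        (fun j hj hj' => hZ j (by omega) hj') rfl
    · exact ih (i - x) (by omega) hkx hi (by omega) hx (Or.inr h)
        (fun j hj hj' => hZ j hj (by omega)) rfl

/-- A segment all of whose inner nodes are open m-connects its ends. -/
theorem not_mSep_of_openTriple {f : ℕ → V} {k l : ℕ} {Z : Set V}
    (hkl : k < l) (hinj : Set.InjOn f (Set.Icc k l))
    (hadj : ∀ i, k ≤ i → i < l → G.Adj (f i) (f (i + 1)))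
    (hopen : ∀ i, k < i → i < l → G.OpenTriple Z (f (i - 1)) (f i) (f (i + 1))) :
    ¬ G.MSep (f k) (f l) Z := by
  obtain ⟨L, hL, -⟩ := (OpenPath.nil (G := G) (Z := Z) (y := f l)).prepend hkl.le hinj (by simp)
    hadj hopen (by simp)
  refine hL.not_mSep fun h => hkl.ne ?_
  exact hinj (Set.mem_Icc.2 ⟨le_rfl, hkl.le⟩) (Set.mem_Icc.2 ⟨hkl.le, le_rfl⟩) h

end ColliderSeg

theorem MSep.ancestors {x y : V} {Z : Set V} (h : G.MSep x y Z) :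
    G.MSep x y {u | ∃ z ∈ Z, G.Anc u z} := by
  rintro ⟨p, hp, ho⟩
  refine h ⟨p, hp, fun a b c ht => ⟨fun hc => ?_, fun hc hb =>
    (ho a b c ht).2 hc ⟨b, hb, Relation.ReflTransGen.refl⟩⟩⟩
  obtain ⟨z, ⟨w, hw, hzw⟩, hbz⟩ := (ho a b c ht).1 hc
  exact ⟨w, hw, hbz.trans hzw⟩

/-- Non-adjacent nodes of a MAG are m-separated by an ancestral set. -/
theorem Maximal.exists_mSep (hG : G.Maximal) {x y : V} (hxy : x ≠ y) (hadj : ¬ G.Adj x y) :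
    ∃ Z : Set V, G.MSep x y Z ∧ ∀ u w, G.DirEdge u w → w ∈ Z → u ∈ Z := by
  obtain ⟨Z, -, -, hZ⟩ := hG x y hxy hadj
  exact ⟨_, hZ.ancestors, fun u w h ⟨z, hz, hw⟩ => ⟨z, hz, Relation.ReflTransGen.head h hw⟩⟩

theorem MarkovEq.adj {M M' : MixedGraph V} (h : MarkovEq M M') (hM : M.WellFormed)
    (hM' : M'.Maximal) {a b : V} (hab : M.Adj a b) : M'.Adj a b := by
  by_contra hn
  have hne := hM.ne_of_adj hab
  obtain ⟨Z, -, -, hZ⟩ := hM' a b hne hn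
  exact (OpenPath.nil.cons hne (by simp) hab (by simp)).not_mSep hne ((h a b Z).2 hZ)

theorem Ancestral.exists_sink (hG : G.Ancestral) (f : ℕ → V) {S : Set ℕ} (hS : S.Finite)
    (hne : S.Nonempty) : ∃ i ∈ S, ∀ w ∈ S, ¬ G.DirEdge (f i) (f w) := by
  let r : ℕ → ℕ → Prop := fun w i => G.StrictAnc (f i) (f w)
  have : IsStrictOrder ℕ r :=
    { irrefl := fun i => hG.1 (f i)
      trans := fun _ _ _ h h' => Relation.TransGen.trans h' h }
  have hwf : S.WellFoundedOn r := hS.wellFoundedOn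
  obtain ⟨i, hi⟩ := hne
  obtain ⟨⟨i, hi⟩, -, h⟩ := WellFounded.has_min hwf Set.univ ⟨⟨i, hi⟩, trivial⟩
  exact ⟨i, hi, fun w hw hd => h ⟨w, hw⟩ trivial (Relation.TransGen.single hd)⟩

section Chords

variable {f : ℕ → V} {k l x y : ℕ}

theorem tail_or_dirEdge_of_not_colliderStep_left (hw : G.WellFormed) (hc : G.NoCircles)
    (hn : ¬ G.ColliderStep f k l x y) (hadj : G.Adj (f x) (f y)) :
    G.mark (f y) (f x) = some Mark.tail ∨ y < l ∧ G.DirEdge (f y) (f x) := by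
  rcases hc.arrow_or_tail (hw.adj_symm hadj) with h | h
  · refine Or.inr ?_
    by_contra hcon
    refine hn ⟨hadj, fun _ => h, fun hy => ?_⟩
    exact (hc.arrow_or_tail hadj).resolve_right fun h' => hcon ⟨hy, h, h'⟩
  · exact Or.inl h

theorem tail_or_dirEdge_of_not_colliderStep_right (hw : G.WellFormed) (hc : G.NoCircles)
    (hn : ¬ G.ColliderStep f k l x y) (hadj : G.Adj (f x) (f y)) :
    G.mark (f x) (f y) = some Mark.tail ∨ k < x ∧ G.DirEdge (f x) (f y) := by
  rcases hc.arrow_or_tail hadj with h | h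
  · refine Or.inr ?_
    by_contra hcon
    refine hn ⟨hadj, fun hx => ?_, fun _ => h⟩
    exact (hc.arrow_or_tail (hw.adj_symm hadj)).resolve_right fun h' => hcon ⟨hx, h, h'⟩
  · exact Or.inl h

theorem colliderStep_of_dirEdge_right (hw : G.WellFormed) (h : G.DirEdge (f l) (f x)) :
    G.ColliderStep f k l x l :=
  ⟨hw.adj_symm (adj_of_mark h.1), fun _ => h.1, fun h => absurd h (lt_irrefl _)⟩

theorem colliderStep_of_dirEdge_left (h : G.DirEdge (f k) (f y)) : G.ColliderStep f k l k y :=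
  ⟨adj_of_mark h.1, fun h => absurd h (lt_irrefl _), fun _ => h.1⟩

end Chords

namespace ColliderSeg

variable {M M' : MixedGraph V} {f : ℕ → V} {k l : ℕ}

/-- On a chordless collider path, at most one node fails to be a collider in an equivalent MAG,
provided that every proper subsegment around such a node has an exit. -/
theorem not_lt_of_not_collider (hM : M.IsMAG) (hp : M.ColliderSeg f k l)
    (hkl : ¬ M.Adj (f k) (f l))
    (hmin : ∀ x y, k ≤ x → x + 2 ≤ y → y ≤ l → ¬ M.ColliderStep f k l x y) {B : Set ℕ}
    (hexit : ∀ j ∈ B, ∀ a b, k ≤ a → a < j → j < b → b ≤ l → (k < a ∨ b < l) →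
      ¬ M.Adj (f a) (f b) →
      (∃ b', j ≤ b' ∧ b' < b ∧ a + 2 ≤ b' ∧ M.DirEdge (f a) (f b')) ∨
        ∃ a', a < a' ∧ a' ≤ j ∧ a' + 2 ≤ b ∧ M.DirEdge (f b) (f a'))
    {i j : ℕ} (hiB : i ∈ B) (hjB : j ∈ B) (hi : k < i) (hj : j < l) : ¬ i < j := by
  obtain ⟨hw, hc, ha, hmax⟩ := hM
  intro hij
  obtain ⟨Z, hZ, hcl⟩ := hmax.exists_mSep (hp.ne le_rfl (by omega) le_rfl) hkl
  set U : Set ℕ := {i | k < i ∧ i < l ∧ f i ∉ Z}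
  have harm : ∀ i ∈ U, M.Arm (f '' U) (f k) (f i) ∨ M.Arm (f '' U) (f l) (f i) := by
    by_contra hcon
    push Not at hcon
    obtain ⟨t, ⟨htU, htk, htl⟩, hsink⟩ := ha.exists_sink f
      (S := {i | i ∈ U ∧ ¬ M.Arm (f '' U) (f k) (f i) ∧ ¬ M.Arm (f '' U) (f l) (f i)})
      ((Set.finite_Icc k l).subset fun i hi => ⟨hi.1.1.le, hi.1.2.1.le⟩) hcon
    have htU' := Set.mem_image_of_mem f htU
    have hno : ∀ w, k < w → w < l → ¬ M.DirEdge (f t) (f w) := fun w hkw hwl h => by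
      have hwU : w ∈ U := ⟨hkw, hwl, fun hwZ => htU.2.2 (hcl _ _ h hwZ)⟩
      exact hsink w ⟨hwU, fun h' => htk (.step htU' h.2 h'), fun h' => htl (.step htU' h.2 h')⟩ h
    obtain ⟨hkt, htl', -⟩ := htU
    rcases (by omega : t < j ∨ i < t) with h | h
    · by_cases hadj : M.Adj (f t) (f l)
      · rcases tail_or_dirEdge_of_not_colliderStep_left hw hc
          (hmin t l hkt.le (by omega) le_rfl) hadj with h | h
        · exact htl (.base htU' h)
        · exact absurd h.1 (lt_irrefl _)
      · rcases hexit j hjB t l hkt.le h hj le_rfl (Or.inl hkt) hadj with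
          ⟨b, h1, h2, -, h3⟩ | ⟨a, h1, h2, h3, h4⟩
        · exact hno b (by omega) h2 h3
        · exact hmin a l (by omega) h3 le_rfl (colliderStep_of_dirEdge_right hw h4)
    · by_cases hadj : M.Adj (f k) (f t)
      · rcases tail_or_dirEdge_of_not_colliderStep_right hw hc
          (hmin k t le_rfl (by omega) htl'.le) hadj with h | h
        · exact htk (.base htU' h)
        · exact absurd h.1 (lt_irrefl _)
      · rcases hexit i hiB k t le_rfl hi h htl'.le (Or.inr htl') hadj with
          ⟨b, h1, h2, h3, h4⟩ | ⟨a, h1, h2, h3, h4⟩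
        · exact hmin k b le_rfl h3 (by omega) (colliderStep_of_dirEdge_left h4)
        · exact hno a h1 (by omega) h4
  exact hp.not_mSep_of_arms hw (fun _ h => h) harm le_rfl (by omega) le_rfl (Or.inl rfl)
    (Or.inl rfl) (fun i h h' => or_iff_not_imp_left.2 fun hZ => ⟨h, h', hZ⟩) hZ

/-- If exactly one node `f j` of a chordless collider path is not a collider in an equivalent MAG,
then every subsegment around `j` with non-adjacent ends has an exit. -/
theorem exists_exit (hM : M.IsMAG) (hM' : M'.Maximal) (hE : MarkovEq M M')
    (hp : M.ColliderSeg f k l)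
    (hmin : ∀ x y, k ≤ x → x + 2 ≤ y → y ≤ l → ¬ M.ColliderStep f k l x y) {j : ℕ}
    (hbad : ¬ M'.Collider (f (j - 1)) (f j) (f (j + 1)))
    (hgood : ∀ i, k < i → i < l → i ≠ j → M'.Collider (f (i - 1)) (f i) (f (i + 1)))
    {a b : ℕ} (hka : k ≤ a) (haj : a < j) (hjb : j < b) (hbl : b ≤ l)
    (hab : ¬ M.Adj (f a) (f b)) :
    (∃ b', j < b' ∧ b' < b ∧ M.DirEdge (f a) (f b')) ∨
      ∃ a', a < a' ∧ a' < j ∧ M.DirEdge (f b) (f a') := by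
  obtain ⟨hw, hc, ha, hmax⟩ := id hM
  induction hd : b - a using Nat.strong_induction_on generalizing a b with
  | _ d ih =>
  by_contra! hno
  obtain ⟨hnoa, hnob⟩ := hno
  have hpab := hp.mono hka hbl
  obtain ⟨Z, hZ, hcl⟩ := hmax.exists_mSep (hpab.ne le_rfl (by omega) le_rfl) hab
  set W : Set ℕ := {i | a < i ∧ i < b ∧ i ≠ j ∧ f i ∉ Z}
  have hfin : W.Finite := (Set.finite_Icc a b).subset fun i hi => ⟨hi.1.le, hi.2.1.le⟩
  have hWb : ∀ i ∈ W, a < i ∧ i < b ∧ f i ∉ Z := fun i hi => ⟨hi.1, hi.2.1, hi.2.2.2⟩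
  have hsucc : ∀ t ∈ W, ∀ w, a < w → w < b → w ≠ j → M.DirEdge (f t) (f w) → w ∈ W :=
    fun t ht w h1 h2 h3 h => ⟨h1, h2, h3, fun hwZ => ht.2.2.2 (hcl _ _ h hwZ)⟩
  have hleft : ∀ t ∈ W, (∀ w ∈ W, ¬ M.DirEdge (f t) (f w)) → t < j →
      M.Arm (f '' W) (f b) (f t) := by
    intro t ht hs htj
    by_cases hadj : M.Adj (f t) (f b)
    · rcases tail_or_dirEdge_of_not_colliderStep_left hw hc
        (hmin t b (hka.trans ht.1.le) (by omega) hbl) hadj with h | h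
      · exact .base (Set.mem_image_of_mem f ht) h
      · exact absurd h.2 (hnob t ht.1 htj)
    · have := ht.1
      rcases ih (b - t) (by omega) (hka.trans ht.1.le) htj hjb hbl hadj rfl with
        ⟨b', h1, h2, h3⟩ | ⟨a', h1, h2, h3⟩
      · exact absurd h3 (hs b' (hsucc t ht b' (by omega) h2 h1.ne' h3))
      · exact absurd h3 (hnob a' (by omega) h2)
  have hright : ∀ t ∈ W, (∀ w ∈ W, ¬ M.DirEdge (f t) (f w)) → j < t →
      M.Arm (f '' W) (f a) (f t) := by
    intro t ht hs hjt
    have htb := ht.2.1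
    by_cases hadj : M.Adj (f a) (f t)
    · rcases tail_or_dirEdge_of_not_colliderStep_right hw hc
        (hmin a t hka (by omega) (by omega)) hadj with h | h
      · exact .base (Set.mem_image_of_mem f ht) h
      · exact absurd h.2 (hnoa t hjt htb)
    · rcases ih (t - a) (by omega) hka haj hjt (by omega) hadj rfl with
        ⟨b', h1, h2, h3⟩ | ⟨a', h1, h2, h3⟩
      · exact absurd h3 (hnoa b' h1 (by omega))
      · exact absurd h3 (hs a' (hsucc t ht a' h1 (by omega) h2.ne h3))
  have harm : ∀ i ∈ W, M.Arm (f '' W) (f a) (f i) ∨ M.Arm (f '' W) (f b) (f i) := by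
    by_contra hcon
    push Not at hcon
    obtain ⟨t, ⟨htW, hta, htb⟩, hsink⟩ := ha.exists_sink f
      (S := {i | i ∈ W ∧ ¬ M.Arm (f '' W) (f a) (f i) ∧ ¬ M.Arm (f '' W) (f b) (f i)})
      (hfin.subset fun i hi => hi.1) hcon
    have htW' := Set.mem_image_of_mem f htW
    have hs : ∀ w ∈ W, ¬ M.DirEdge (f t) (f w) := fun w hwW h =>
      hsink w ⟨hwW, fun h' => hta (.step htW' h.2 h'), fun h' => htb (.step htW' h.2 h')⟩ h
    rcases lt_or_gt_of_ne htW.2.2.1 with h | h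
    · exact htb (hleft t htW hs h)
    · exact hta (hright t htW hs h)
  by_cases hjZ : f j ∈ Z
  · refine hpab.not_mSep_of_arms hw hWb harm le_rfl (by omega) le_rfl (Or.inl rfl) (Or.inl rfl)
      (fun i h h' => ?_) hZ
    by_cases hij : i = j
    · exact Or.inl (hij ▸ hjZ)
    · exact or_iff_not_imp_left.2 fun hiZ => ⟨h, h', hij, hiZ⟩
  by_cases hne : W.Nonempty
  · obtain ⟨t, htW, hs⟩ := ha.exists_sink f hfin hne
    obtain ⟨hat, htb, htj, -⟩ := id htW
    rcases lt_or_gt_of_ne htj with h | h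
    · exact hpab.not_mSep_of_arms hw hWb harm le_rfl hat htb.le (Or.inl rfl)
        (Or.inr (hleft t htW hs h))
        (fun i h h' => or_iff_not_imp_left.2 fun hiZ => ⟨h, by omega, by omega, hiZ⟩) hZ
    · exact hpab.not_mSep_of_arms hw hWb harm hat.le htb le_rfl (Or.inr (hright t htW hs h))
        (Or.inl rfl)
        (fun i h h' => or_iff_not_imp_left.2 fun hiZ => ⟨by omega, h', by omega, hiZ⟩) hZ
  · refine not_mSep_of_openTriple (G := M') (by omega) hpab.inj
      (fun i h h' => hE.adj hw hM' (hpab.step i h h').1) (fun i h h' => ?_) ((hE _ _ _).1 hZ)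
    by_cases hij : i = j
    · subst hij
      exact ⟨fun h => absurd h hbad, fun _ => hjZ⟩
    · refine ⟨fun _ => ?_, fun h'' => absurd (hgood i (by omega) (by omega) hij) h''⟩
      by_contra hiZ
      exact hne ⟨i, h, h', hij, hiZ⟩

/-- Contracting the segment along the edge between `f x` and `f y`. -/
theorem contract (hp : G.ColliderSeg f k l) {x y : ℕ} (hkx : k ≤ x) (hxy : x + 2 ≤ y)
    (hyl : y ≤ l) (h : G.ColliderStep f k l x y) :
    G.ColliderSeg (fun i => f (if i ≤ x then i else i + (y - x - 1))) k (l - (y - x - 1)) where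
  inj := by
    intro i hi j hj hij
    rw [Set.mem_Icc] at hi hj
    have := hp.inj (by rw [Set.mem_Icc]; split_ifs <;> omega)
      (by rw [Set.mem_Icc]; split_ifs <;> omega) hij
    split_ifs at this <;> omega
  step := by
    intro i hi hi'
    rcases lt_trichotomy i x with hix | rfl | hix
    · have h' := hp.step i hi (by omega)
      simp only [ColliderStep, if_pos hix.le, if_pos (by omega : i + 1 ≤ x)]
      exact ⟨h'.1, h'.2.1, fun _ => h'.2.2 (by omega)⟩
    · simp only [ColliderStep, if_pos le_rfl, if_neg (by omega : ¬ i + 1 ≤ i),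
        (by omega : i + 1 + (y - i - 1) = y)]
      exact ⟨h.1, h.2.1, fun _ => h.2.2 (by omega)⟩
    · have h' := hp.step (i + (y - x - 1)) (by omega) (by omega)
      rw [(by omega : i + (y - x - 1) + 1 = i + 1 + (y - x - 1))] at h'
      simp only [ColliderStep, if_neg (by omega : ¬ i ≤ x), if_neg (by omega : ¬ i + 1 ≤ x)]
      exact ⟨h'.1, fun _ => h'.2.1 (by omega), fun _ => h'.2.2 (by omega)⟩

/-- A node of a collider path between non-adjacent nodes over which no edge shortens the path is a
collider in every Markov equivalent MAG. -/
theorem collider_of_markovEq (hM : M.IsMAG) (hM' : M'.IsMAG) (hE : MarkovEq M M')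
    (hp : M.ColliderSeg f k l) (hkl : ¬ M.Adj (f k) (f l)) {j : ℕ} (hj : k < j) (hj' : j < l)
    (hmin : ∀ x y, k ≤ x → x + 2 ≤ y → y ≤ l → x ≤ j → j ≤ y → ¬ M.ColliderStep f k l x y) :
    M'.Collider (f (j - 1)) (f j) (f (j + 1)) := by
  induction hn : l - k using Nat.strong_induction_on generalizing f k l j with
  | _ n ih =>
  by_cases hchord : ∃ x y, k ≤ x ∧ x + 2 ≤ y ∧ y ≤ l ∧ M.ColliderStep f k l x y
  · obtain ⟨x, y, hkx, hxy, hyl, hstep⟩ := hchord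
    have hp' := hp.contract hkx hxy hyl hstep
    have key : ∀ j', k < j' → (if j' ≤ x then j' else j' + (y - x - 1)) = j →
        j' < l - (y - x - 1) → ∀ u v, k ≤ u → u + 2 ≤ v → v ≤ l - (y - x - 1) → u ≤ j' → j' ≤ v →
        ¬ M.ColliderStep (fun i => f (if i ≤ x then i else i + (y - x - 1))) k
          (l - (y - x - 1)) u v := by
      intro j' h1 h2 h3 u v hu huv hv huj hjv hs
      refine hmin (if u ≤ x then u else u + (y - x - 1)) (if v ≤ x then v else v + (y - x - 1))
        ?_ ?_ ?_ ?_ ?_ ⟨hs.1, fun h => hs.2.1 ?_, fun h => hs.2.2 ?_⟩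
      all_goals split_ifs at * <;> omega
    have hkl' : ¬ M.Adj (f (if k ≤ x then k else k + (y - x - 1)))
        (f (if l - (y - x - 1) ≤ x then l - (y - x - 1) else l - (y - x - 1) + (y - x - 1))) := by
      rwa [if_pos hkx, if_neg (by omega), Nat.sub_add_cancel (by omega)]
    rcases (by by_contra! h; exact hmin x y hkx hxy hyl h.2 h.1 hstep : y < j ∨ j < x) with h | h
    · have := ih (l - (y - x - 1) - k) (by omega) hp' hkl' (j := j - (y - x - 1)) (by omega)
        (by omega) (key _ (by omega) (by rw [if_neg (by omega)]; omega) (by omega)) rfl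
      simp only [if_neg (by omega : ¬ j - (y - x - 1) - 1 ≤ x),
        if_neg (by omega : ¬ j - (y - x - 1) ≤ x), if_neg (by omega : ¬ j - (y - x - 1) + 1 ≤ x),
        (by omega : j - (y - x - 1) - 1 + (y - x - 1) = j - 1),
        (by omega : j - (y - x - 1) + (y - x - 1) = j),
        (by omega : j - (y - x - 1) + 1 + (y - x - 1) = j + 1)] at this
      exact this
    · have := ih (l - (y - x - 1) - k) (by omega) hp' hkl' hj
        (by omega) (key _ hj (if_pos h.le) (by omega)) rfl
      simpa only [if_pos (by omega : j - 1 ≤ x), if_pos h.le, if_pos (by omega : j + 1 ≤ x)]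
        using this
  · push Not at hchord
    obtain ⟨hw, hc, -⟩ := id hM
    set B : Set ℕ := {i | k < i ∧ i < l ∧ ¬ M'.Collider (f (i - 1)) (f i) (f (i + 1))}
    have hexit : ∀ j ∈ B, ∀ a b, k ≤ a → a < j → j < b → b ≤ l → (k < a ∨ b < l) →
        ¬ M.Adj (f a) (f b) →
        (∃ b', j ≤ b' ∧ b' < b ∧ a + 2 ≤ b' ∧ M.DirEdge (f a) (f b')) ∨
          ∃ a', a < a' ∧ a' ≤ j ∧ a' + 2 ≤ b ∧ M.DirEdge (f b) (f a') := by
      intro i hi a b hka hai hib hbl hprop hab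
      by_contra! hno
      obtain ⟨hnoa, hnob⟩ := hno
      refine hi.2.2 (ih (b - a) (by omega) (hp.mono hka hbl) hab hai hib ?_ rfl)
      intro x y hax hxy hyb hxi hiy hs
      have hns := hchord x y (by omega) hxy (by omega)
      rcases hax.eq_or_lt with rfl | hax
      · have hyb' : y < b := lt_of_le_of_ne hyb (by rintro rfl; exact hab hs.1)
        rcases tail_or_dirEdge_of_not_colliderStep_right hw hc hns hs.1 with h | h
        · simp [hs.2.2 hyb'] at h
        · exact hnoa y hiy hyb' hxy h.2
      · rcases hyb.eq_or_lt with rfl | hyb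
        · rcases tail_or_dirEdge_of_not_colliderStep_left hw hc hns hs.1 with h | h
          · simp [hs.2.1 hax] at h
          · exact hnob x hax hxi hxy h.2
        · exact hns ⟨hs.1, fun _ => hs.2.1 hax, fun _ => hs.2.2 hyb⟩
    by_contra hbad
    have hjB : j ∈ B := ⟨hj, hj', hbad⟩
    have hgood : ∀ i, k < i → i < l → i ≠ j → M'.Collider (f (i - 1)) (f i) (f (i + 1)) := by
      intro i hi hi' hij
      by_contra hcon
      have hiB : i ∈ B := ⟨hi, hi', hcon⟩
      rcases lt_or_gt_of_ne hij with h | h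
      · exact hp.not_lt_of_not_collider hM hkl hchord hexit hiB hjB hi hj' h
      · exact hp.not_lt_of_not_collider hM hkl hchord hexit hjB hiB hj hi' h
    rcases hp.exists_exit hM hM'.2.2.2 hE hchord hbad hgood le_rfl hj hj' le_rfl hkl with
      ⟨b, h1, h2, h3⟩ | ⟨a, h1, h2, h3⟩
    · exact hchord k b le_rfl (by omega) h2.le (colliderStep_of_dirEdge_left h3)
    · exact hchord a l h1.le (by omega) le_rfl (colliderStep_of_dirEdge_right hw h3)

end ColliderSeg

section Lists

variable {p : List V} {f : ℕ → V}

theorem colliderSeg_of_isPath (hf : ∀ i, i < p.length → p[i]? = some (f i)) (hp : G.IsPath p)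
    (hcol : G.AllColliders p) : G.ColliderSeg f 0 (p.length - 1) := by
  obtain ⟨hlen, hnd, hchain⟩ := hp
  refine ⟨fun i hi j hj hij => ?_, fun i _ hi => ⟨?_, fun h => ?_, fun h => ?_⟩⟩
  · rw [Set.mem_Icc] at hi hj
    refine (List.getElem?_inj (by omega) hnd).1 ?_
    rw [hf i (by omega), hf j (by omega), hij]
  · have h := List.isChain_iff_getElem.1 hchain i (by omega)
    have h1 := hf i (by omega)
    have h2 := hf (i + 1) (by omega)
    rw [List.getElem?_eq_getElem (by omega), Option.some_inj] at h1 h2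
    rwa [h1, h2] at h
  · obtain ⟨i, rfl⟩ := Nat.exists_eq_add_of_lt h
    rw [zero_add] at *
    exact (hcol _ _ _ ⟨i, hf _ (by omega), hf _ (by omega), hf _ (by omega)⟩).2
  · exact (hcol _ _ _ ⟨i, hf _ (by omega), hf _ (by omega), hf _ (by omega)⟩).1

theorem ColliderSeg.isPath (hlen : 2 ≤ p.length) (hf : ∀ i, i < p.length → p[i]? = some (f i))
    (h : G.ColliderSeg f 0 (p.length - 1)) : G.IsPath p ∧ G.AllColliders p := by
  have hf' : ∀ i (hi : i < p.length), p[i] = f i := fun i hi => by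
    simpa [hi] using hf i hi
  refine ⟨⟨hlen, ?_, ?_⟩, ?_⟩
  · refine List.nodup_iff_injective_getElem.2 fun i j hij => Fin.ext (h.inj ?_ ?_ ?_)
    · exact Set.mem_Icc.2 ⟨by omega, by omega⟩
    · exact Set.mem_Icc.2 ⟨by omega, by omega⟩
    · simpa [hf'] using hij
  · refine List.isChain_iff_getElem.2 fun i hi => ?_
    rw [hf' _ (by omega), hf' _ (by omega)]
    exact (h.step i (by omega) (by omega)).1
  · rintro a b c ⟨i, h1, h2, h3⟩
    have hi := (List.getElem?_eq_some_iff.1 h3).1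
    rw [hf _ (by omega), Option.some_inj] at h1 h2 h3
    subst h1 h2 h3
    exact h.collider (i := i + 1) (by omega) (by omega)

/-- Shortcutting `p` from position `x` to position `y`. -/
theorem getElem?_shortcut {x y i : ℕ} (hxy : x < y) (hy : y < p.length) :
    (p.take (x + 1) ++ p.drop y)[i]? = p[if i ≤ x then i else i + (y - x - 1)]? := by
  rw [List.getElem?_append, List.length_take, min_eq_left (by omega)]
  split_ifs with h1 h2 h2
  · rw [List.getElem?_take_of_lt h1]
  · omega
  · omega
  · rw [List.getElem?_drop]
    congr 1
    omega

end Lists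

/-- An edge shortening a collider path yields a shorter collider path over a subsequence. -/
theorem exists_shorter {p : List V} {f : ℕ → V} {X Y : V}
    (hf : ∀ i, i < p.length → p[i]? = some (f i)) (hp : G.IsPathBetween X Y p)
    (hcol : G.AllColliders p) {x y : ℕ} (hxy : x + 2 ≤ y) (hy : y ≤ p.length - 1)
    (h : G.ColliderStep f 0 (p.length - 1) x y) :
    ∃ q : List V, q.Sublist p ∧ G.IsPathBetween X Y q ∧ G.AllColliders q ∧
      q.length < p.length := by
  have hseg := (colliderSeg_of_isPath hf hp.1 hcol).contract (Nat.zero_le x) hxy hy h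
  obtain ⟨hpath, hhead, hlast⟩ := hp
  have hlen : (p.take (x + 1) ++ p.drop y).length = x + 1 + (p.length - y) := by
    rw [List.length_append, List.length_take, List.length_drop, min_eq_left (by omega)]
  have hget := fun i => getElem?_shortcut (p := p) (x := x) (y := y) (i := i) (by omega) (by omega)
  have hq := ColliderSeg.isPath (G := G) (p := p.take (x + 1) ++ p.drop y)
    (f := fun i => f (if i ≤ x then i else i + (y - x - 1))) (by omega)
    (fun i hi => by rw [hget, hf _ (by split_ifs <;> omega)])
    (by rwa [hlen, (by omega : x + 1 + (p.length - y) - 1 = p.length - 1 - (y - x - 1))])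
  refine ⟨_, ?_, ⟨hq.1, ?_, ?_⟩, hq.2, by omega⟩
  · conv_rhs => rw [← List.take_append_drop (x + 1) p]
    exact (List.Sublist.refl _).append (List.drop_sublist_drop_left _ (by omega))
  · rw [List.head?_eq_getElem?] at hhead ⊢
    simpa [hget] using hhead
  · rw [List.getLast?_eq_getElem?] at hlast ⊢
    rw [hget, hlen, if_neg (by omega), ← hlast]
    congr 1
    omega

/-- Every inner node of a shortest collider path between non-adjacent nodes of a MAG is a collider
on it in every Markov equivalent MAG. -/
theorem collider_of_shortest {M M' : MixedGraph V} (hM : M.IsMAG) (hM' : M'.IsMAG)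
    (hE : MarkovEq M M') {X Y : V} (hadj : ¬ M.Adj X Y) {p : List V}
    (hp : M.IsPathBetween X Y p) (hcol : M.AllColliders p)
    (hshort : ∀ q : List V, q.Sublist p → M.IsPathBetween X Y q → M.AllColliders q →
      p.length ≤ q.length) {a b c : V} (ht : ListTriple p a b c) : M'.Collider a b c := by
  set f : ℕ → V := fun i => p[i]?.getD X with hfdef
  have hf : ∀ i, i < p.length → p[i]? = some (f i) := fun i hi => by simp [hfdef, hi]
  have hseg := colliderSeg_of_isPath hf hp.1 hcol
  have hlen := hp.1.1
  have h0 : f 0 = X := by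
    have := hp.2.1
    rwa [List.head?_eq_getElem?, hf 0 (by omega), Option.some_inj] at this
  have hl : f (p.length - 1) = Y := by
    have := hp.2.2
    rwa [List.getLast?_eq_getElem?, hf _ (by omega), Option.some_inj] at this
  obtain ⟨i, h1, h2, h3⟩ := ht
  have hi := (List.getElem?_eq_some_iff.1 h3).1
  rw [hf _ (by omega), Option.some_inj] at h1 h2 h3
  subst h1 h2 h3
  refine hseg.collider_of_markovEq hM hM' hE (by rwa [h0, hl]) (j := i + 1) (by omega) (by omega)
    fun x y _ hxy hy _ _ hs => ?_
  obtain ⟨q, hq1, hq2, hq3, hq4⟩ := exists_shorter hf hp hcol hxy hy hs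
  exact absurd (hshort q hq1 hq2 hq3) (by omega)

end MixedGraph

/-- **claims II and II*.** For a shortest collider path `p` between the
non-adjacent nodes `X` and `Y` of the MAG `M`: if an internal node `O_j` is not of
definite status on `p` in the PAG `P`, then `O_{j+1}` is a parent of `O_{j-1}` in `M`
and, symmetrically, `O_{j-1}` is a parent of `O_{j+1}` in `M`; consequently every
internal node of `p` is of definite status in `P`. -/
theorem shortest_collider_path_claims {V : Type} (M : MixedGraph V) (hM : M.IsMAG)
    (P : MixedGraph V) (hP : IsPAGof P M)
    (X Y : V) (hadj : ¬ M.Adj X Y)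
    (p : List V) (hp : M.IsPathBetween X Y p) (hcol : M.AllColliders p)
    (hshort : ∀ q : List V, q.Sublist p → M.IsPathBetween X Y q → M.AllColliders q →
      p.length ≤ q.length) :
    (∀ a b c : V, ListTriple p a b c →
      ¬ (P.Collider a b c ∨ P.DefNonCollider a b c) →
      M.DirEdge c a ∧ M.DirEdge a c) ∧
    P.DefStatusPath p := by
  have hC : ∀ a b c : V, ListTriple p a b c → P.Collider a b c := by
    intro a b c ht
    have hMC := hcol a b c ht
    have hab := (hP.1 a b).2 (MixedGraph.adj_of_mark hMC.1)
    have hcb := (hP.1 c b).2 (MixedGraph.adj_of_mark hMC.2)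
    exact ⟨(hP.2 a b hab).1.2 fun M' hM' hE =>
        (MixedGraph.collider_of_shortest hM hM' hE hadj hp hcol hshort ht).1,
      (hP.2 c b hcb).1.2 fun M' hM' hE =>
        (MixedGraph.collider_of_shortest hM hM' hE hadj hp hcol hshort ht).2⟩
  exact ⟨fun a b c ht hn => absurd (Or.inl (hC a b c ht)) hn,
    fun a b c ht => Or.inl (hC a b c ht)⟩

end CG
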